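/- Let p be a prime. The rank over the field with p elements of the oppositeness matrix of generators of the Hermitian polar space H(5, p^2) is at most p^5 - p^4 + p^3 - p^2 + p. -/

import Mathlib

open MvPolynomial in
/-- The product of the `(p - 1)`-st powers of the linear forms given by the rows of `M`. -/
noncomputable def rowProd {ι κ F : Type*} [Fintype ι] [Fintype κ] [Field F] (p : ℕ)
    (M : Matrix ι κ F) : MvPolynomial κ F :=
  ∏ i, (∑ k, C (M i k) * X k) ^ (p - 1)

/-- The exponent all of whose entries are `p - 1`. -/
noncomputable def topExponent (ι : Type*) [Finite ι] (p : ℕ) : ι →₀ ℕ :=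
  Finsupp.equivFunOnFinite.symm fun _ => p - 1

/-- The exponents of total degree `N` all of whose entries are less than `p`. -/
def truncatedExponents (κ : Type*) [Fintype κ] [DecidableEq κ] (p N : ℕ) : Finset (κ →₀ ℕ) :=
  {d ∈ Finset.finsuppAntidiag Finset.univ N | ∀ k, d k < p}

section TruncatedPowers

open MvPolynomial

variable {ι κ F : Type*} [Fintype ι] [DecidableEq ι] [Fintype κ] [DecidableEq κ] [Field F]
  (p : ℕ) [Fact p.Prime]

theorem mem_truncatedExponents {p N : ℕ} {d : κ →₀ ℕ} :
    d ∈ truncatedExponents κ p N ↔ ∑ k, d k = N ∧ ∀ k, d k < p := by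
  simp [truncatedExponents, Finset.mem_finsuppAntidiag]

omit [DecidableEq ι] in
theorem coeff_topExponent_mul_pow_eq_zero [CharP F p] (f : MvPolynomial ι F) (c : ι → F) :
    coeff (topExponent ι p) (f * (∑ j, C (c j) * X j) ^ p) = 0 := by
  have hp := (Fact.out : p.Prime).pos
  rw [sum_pow_char, Finset.mul_sum, coeff_sum]
  refine Finset.sum_eq_zero fun j _ => ?_
  rw [mul_pow, ← C_pow, C_mul_X_pow_eq_monomial, coeff_mul_monomial', if_neg]
  intro h
  have := h j
  simp [topExponent] at this
  omega

omit [DecidableEq ι] [DecidableEq κ] [Fact p.Prime] in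
theorem isHomogeneous_rowProd (M : Matrix ι κ F) :
    (rowProd p M).IsHomogeneous (Fintype.card ι * (p - 1)) := by
  have := IsHomogeneous.prod (Finset.univ : Finset ι)
    (fun i => (∑ k, C (M i k) * X k : MvPolynomial κ F) ^ (p - 1)) (fun _ => 1 * (p - 1))
    fun i _ => (IsHomogeneous.sum _ _ _ fun k _ => isHomogeneous_C_mul_X _ _).pow _
  simpa [rowProd] using this

omit [DecidableEq ι] [DecidableEq κ] [Fact p.Prime] in
theorem rowProd_mul {τ : Type*} [Fintype τ] (A : Matrix ι κ F) (B : Matrix κ τ F) :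
    rowProd p (A * B) = aeval (fun k => ∑ j, C (B k j) * X j) (rowProd p A) := by
  simp only [rowProd, map_prod, map_pow, map_sum, map_mul, aeval_X, algHom_C, algebraMap_eq]
  refine Finset.prod_congr rfl fun i _ => ?_
  congr 1
  simp only [Matrix.mul_apply, map_sum, map_mul, Finset.mul_sum, Finset.sum_mul]
  rw [Finset.sum_comm]
  simp only [mul_assoc]

omit [DecidableEq ι] in
theorem coeff_rowProd_mul [CharP F p] (A : Matrix ι κ F) (B : Matrix κ ι F) :
    coeff (topExponent ι p) (rowProd p (A * B)) =
      ∑ d ∈ truncatedExponents κ p (Fintype.card ι * (p - 1)),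
        coeff d (rowProd p A) *
          coeff (topExponent ι p) (∏ k, (∑ j, C (B k j) * X j) ^ d k) := by
  rw [rowProd_mul, aeval_def, eval₂_eq', coeff_sum]
  simp only [algebraMap_eq, coeff_C_mul]
  refine Finset.sum_congr_of_eq_on_inter ?_ ?_ fun _ _ _ => rfl
  · intro d hd hd'
    have hdeg : ∑ k, d k = Fintype.card ι * (p - 1) := by
      by_contra h
      refine (mem_support_iff.1 hd) ((isHomogeneous_rowProd p A).coeff_eq_zero ?_)
      rwa [Finsupp.degree_eq_sum]
    obtain ⟨k, hk⟩ : ∃ k, p ≤ d k := by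
      by_contra! h
      exact hd' (mem_truncatedExponents.2 ⟨hdeg, h⟩)
    rw [← Finset.prod_erase_mul _ _ (Finset.mem_univ k), ← Nat.sub_add_cancel hk, pow_add,
      ← mul_assoc, coeff_topExponent_mul_pow_eq_zero, mul_zero]
  · intro d _ hd
    rw [notMem_support_iff.1 hd, zero_mul]

theorem truncatedExponents_card_mul :
    truncatedExponents ι p (Fintype.card ι * (p - 1)) = {topExponent ι p} := by
  have hp := (Fact.out : p.Prime).pos
  ext d
  rw [mem_truncatedExponents, Finset.mem_singleton]
  constructor
  · rintro ⟨hs, hd⟩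
    have h := (Finset.sum_eq_sum_iff_of_le (s := Finset.univ) (f := d) (g := fun _ : ι => p - 1)
      fun k _ => by have := hd k; omega).1 (by simpa using hs)
    ext k
    simpa [topExponent] using h k (Finset.mem_univ k)
  · rintro rfl
    simp [topExponent, hp]

theorem coeff_rowProd_mul_square [CharP F p] (A B : Matrix ι ι F) :
    coeff (topExponent ι p) (rowProd p (A * B)) =
      coeff (topExponent ι p) (rowProd p A) * coeff (topExponent ι p) (rowProd p B) := by
  rw [coeff_rowProd_mul, truncatedExponents_card_mul, Finset.sum_singleton]
  simp [rowProd, topExponent]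

omit [Fact p.Prime] in
theorem coeff_rowProd_diagonal (d : ι → F) :
    coeff (topExponent ι p) (rowProd p (Matrix.diagonal d)) = (∏ i, d i) ^ (p - 1) := by
  have h (i : ι) : ∑ k, C (Matrix.diagonal d i k) * X k = (C (d i) * X i : MvPolynomial ι F) := by
    rw [Finset.sum_eq_single i] <;> simp +contextual [eq_comm]
  have h' : ∏ i, (X i : MvPolynomial ι F) ^ (p - 1) = monomial (topExponent ι p) 1 := by
    simp [monomial_eq, Finsupp.prod_fintype, topExponent]
  simp only [rowProd, h, mul_pow, Finset.prod_mul_distrib, h', ← C_pow, ← map_prod, coeff_C_mul,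
    coeff_monomial, if_true, mul_one, Finset.prod_pow]

theorem coeff_rowProd_transvection [CharP F p] {i j : ι} (hij : i ≠ j) (c : F) :
    coeff (topExponent ι p) (rowProd p (Matrix.transvection i j c)) = 1 := by
  have h1 : coeff (topExponent ι p) (rowProd p (1 : Matrix ι ι F)) = 1 := by
    rw [← Matrix.diagonal_one, coeff_rowProd_diagonal]
    simp
  have hn (n : ℕ) : coeff (topExponent ι p) (rowProd p (Matrix.transvection i j (n * c))) =
      coeff (topExponent ι p) (rowProd p (Matrix.transvection i j c)) ^ n := by
    induction n with
    | zero => simp [h1]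
    | succ n ih =>
      rw [pow_succ, ← ih, ← coeff_rowProd_mul_square,
        Matrix.transvection_mul_transvection_same i j hij]
      push_cast
      ring_nf
  have hc := hn p
  rw [CharP.cast_eq_zero, zero_mul, Matrix.transvection_zero, h1] at hc
  apply frobenius_inj F p
  simp [frobenius_def, ← hc]

/-- The coefficient of `∏ i, X i ^ (p - 1)` in `∏ i, (M X) i ^ (p - 1)` is `det M ^ (p - 1)`. -/
theorem coeff_rowProd_eq_det_pow [CharP F p] (M : Matrix ι ι F) :
    coeff (topExponent ι p) (rowProd p M) = M.det ^ (p - 1) := by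
  refine Matrix.diagonal_transvection_induction
    (fun M => coeff (topExponent ι p) (rowProd p M) = M.det ^ (p - 1)) M ?_ ?_ ?_
  · intro d _
    rw [coeff_rowProd_diagonal, Matrix.det_diagonal]
  · intro t
    rw [t.det, one_pow]
    exact coeff_rowProd_transvection p t.hij t.c
  · intro A B hA hB
    rw [coeff_rowProd_mul_square, hA, hB, Matrix.det_mul, mul_pow]

end TruncatedPowers

theorem Matrix.rank_le_rank_map {m K L : Type*} [Fintype m] [Field K] [Field L]
    (f : K →+* L) (M : Matrix m m K) : M.rank ≤ (M.map f).rank := by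
  classical
  obtain ⟨V, U, e, -, -, h⟩ := M.exists_rank_normal_form
  have h' := congrArg (fun N : Matrix m m K => N.map f) h
  rw [Matrix.map_mul, Matrix.map_mul, ← Matrix.submatrix_map, Matrix.fromBlocks_map,
    Matrix.map_zero f f.map_zero, Matrix.map_zero f f.map_zero, Matrix.map_zero f f.map_zero,
    Matrix.map_one f f.map_zero f.map_one] at h'
  have hr : (Matrix.fromBlocks 1 0 0 0 : Matrix (Fin M.rank ⊕ Fin (Fintype.card m - M.rank))
      (Fin M.rank ⊕ Fin (Fintype.card m - M.rank)) L).rank = M.rank := by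
    rw [← Matrix.diagonal_one, ← Matrix.diagonal_zero, Matrix.fromBlocks_diagonal,
      Matrix.rank_diagonal, Fintype.card_subtype, Finset.card_filter,
      Fintype.sum_sum_type]
    simp
  calc M.rank = (V.map f * M.map f * U.map f).rank := by rw [h', Matrix.rank_submatrix, hr]
    _ ≤ (V.map f * M.map f).rank := Matrix.rank_mul_le_left _ _
    _ ≤ (M.map f).rank := Matrix.rank_mul_le_right _ _

section Gram

open Matrix

variable {n F : Type*} [Fintype n] [DecidableEq n] [Field F] (φ : F →+* F)

theorem det_mul_map_transpose_eq {A A' : Matrix n (n ⊕ n) F} (B : Matrix n (n ⊕ n) F)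
    (hA : A * (A.map φ)ᵀ = 0) (hA' : A' * (A.map φ)ᵀ = 1) :
    (A * (B.map φ)ᵀ).det = (fromRows A A').det * φ (fromRows B A).det := by
  have h : fromRows A A' * ((fromRows B A).map φ)ᵀ =
      fromBlocks (A * (B.map φ)ᵀ) 0 (A' * (B.map φ)ᵀ) 1 := by
    rw [fromRows_map, transpose_fromRows, fromRows_mul_fromCols, hA, hA']
  have h' := congrArg det h
  rw [det_mul, det_transpose, det_fromBlocks_zero₁₂, det_one, mul_one] at h'
  rw [← h', RingHom.map_det, RingHom.mapMatrix_apply]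

theorem exists_det_fromRows_ne_zero {A : Matrix n (n ⊕ n) F} (hli : LinearIndependent F A.row)
    (hA : A * (A.map φ)ᵀ = 0) :
    ∃ A' : Matrix n (n ⊕ n) F, A' * (A.map φ)ᵀ = 1 ∧ (fromRows A A').det ≠ 0 := by
  have hsurj : Function.Surjective A.mulVec := by
    have hr := hli.rank_matrix
    rw [Matrix.rank, ← Module.finrank_fintype_fun_eq_card (R := F)] at hr
    exact LinearMap.range_eq_top.1 (Submodule.eq_top_of_finrank_eq hr)
  obtain ⟨T, hT⟩ := mulVec_surjective_iff_exists_right_inverse.1 hsurj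
  have hA' : (T.map φ)ᵀ * (A.map φ)ᵀ = 1 := by
    rw [← transpose_mul, ← Matrix.map_mul, hT, Matrix.map_one φ φ.map_zero φ.map_one, transpose_one]
  refine ⟨(T.map φ)ᵀ, hA', ?_⟩
  rw [← isUnit_iff_ne_zero, ← isUnit_iff_isUnit_det, ← vecMul_injective_iff_isUnit]
  refine (injective_iff_map_eq_zero (vecMulLinear (fromRows A (T.map φ)ᵀ))).2 fun v hv => ?_
  rw [vecMulLinear_apply, vecMul_fromRows] at hv
  have hr : v ∘ Sum.inr = 0 := by
    have h := congrArg (fun w => w ᵥ* (A.map φ)ᵀ) hv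
    simpa [add_vecMul, vecMul_vecMul, hA, hA'] using h
  have hl : v ∘ Sum.inl = 0 := by
    rw [hr, zero_vecMul, add_zero] at hv
    exact vecMul_injective_iff.2 hli (by simpa using hv)
  ext (i | i)
  · exact congrFun hl i
  · exact congrFun hr i

theorem det_fromRows_swap (A B : Matrix n (n ⊕ n) F) :
    (fromRows A B).det =
      ((Equiv.Perm.sign (Equiv.sumComm n n) : ℤ) : F) * (fromRows B A).det := by
  rw [← det_permute]
  congr 1
  ext (i | i) j <;> rfl

end Gram
section Counting

open Finset

theorem card_filter_add_le (p s x : ℕ) :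
    #{t ∈ range p ×ˢ range p | x + t.1 + t.2 = s} ≤ min p (s + 1 - x) - (s + 1 - p - x) := by
  rw [← Nat.card_Ico]
  refine card_le_card_of_injOn Prod.fst ?_ ?_
  · intro t ht
    simp only [coe_filter, mem_product, mem_range, Set.mem_ofPred_eq, coe_Ico, Set.mem_Ico] at ht ⊢
    omega
  · rintro ⟨a, b⟩ ht ⟨c, d⟩ ht' h
    simp only [coe_filter, mem_product, mem_range, Set.mem_ofPred_eq] at ht ht' h
    ext <;> simp only <;> omega

theorem card_filter_add_add_le {p : ℕ} (hp : 4 ≤ p) (s : ℕ) :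
    #{t ∈ range p ×ˢ range p ×ˢ range p | t.1 + t.2.1 + t.2.2 = s} ≤ p ^ 2 - p := by
  have hsum : #{t ∈ range p ×ˢ range p ×ˢ range p | t.1 + t.2.1 + t.2.2 = s} =
      ∑ x ∈ range p, #{t ∈ range p ×ˢ range p | x + t.1 + t.2 = s} := by
    simp only [card_filter, sum_product]
  rw [hsum]
  refine (sum_le_sum fun x _ => card_filter_add_le p s x).trans ?_
  obtain ⟨n, rfl⟩ := Nat.exists_eq_add_of_le' hp
  rw [sum_range_succ, sum_range_succ, sum_range_succ', sum_range_succ']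
  have hmid : ∑ x ∈ range n, (min (n + 4) (s + 1 - (x + 1 + 1)) - (s + 1 - (n + 4) - (x + 1 + 1)))
      ≤ n * (n + 4) := by
    simpa using sum_le_card_nsmul (range n) _ (n + 4) fun x _ =>
      (Nat.sub_le _ _).trans (min_le_left (n + 4) (s + 1 - (x + 1 + 1)))
  have hsq : (n + 4) ^ 2 - (n + 4) = n * (n + 4) + 3 * n + 12 := by
    rw [Nat.sub_eq_iff_eq_add (by nlinarith)]
    ring
  have hout : min (n + 4) (s + 1 - 0) - (s + 1 - (n + 4) - 0) +
      (min (n + 4) (s + 1 - (n + 3)) - (s + 1 - (n + 4) - (n + 3))) ≤ n + 5 := by omega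
  have hin : min (n + 4) (s + 1 - (0 + 1)) - (s + 1 - (n + 4) - (0 + 1)) +
      (min (n + 4) (s + 1 - (n + 2)) - (s + 1 - (n + 4) - (n + 2))) ≤ n + 7 := by omega
  rw [hsq]
  linarith

theorem card_filter_sum_six_le {p : ℕ} (hp : 2 ≤ p) :
    #{t ∈ (range p ×ˢ range p ×ˢ range p) ×ˢ (range p ×ˢ range p ×ˢ range p) |
      (t.1.1 + t.1.2.1 + t.1.2.2) + (t.2.1 + t.2.2.1 + t.2.2.2) = 3 * (p - 1)} ≤
      p ^ 5 - p ^ 4 + p ^ 3 - p ^ 2 + p := by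
  obtain rfl | rfl | h4 : p = 2 ∨ p = 3 ∨ 4 ≤ p := by omega
  · decide +kernel
  · decide +kernel
  have hle : #{t ∈ (range p ×ˢ range p ×ˢ range p) ×ˢ (range p ×ˢ range p ×ˢ range p) |
      (t.1.1 + t.1.2.1 + t.1.2.2) + (t.2.1 + t.2.2.1 + t.2.2.2) = 3 * (p - 1)} ≤
      p ^ 3 * (p ^ 2 - p) := by
    rw [card_filter, sum_product]
    have hcard : #(range p ×ˢ range p ×ˢ range p) = p ^ 3 := by
      simp only [card_product, card_range]
      ring
    rw [← hcard, ← smul_eq_mul]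
    refine sum_le_card_nsmul _ _ _ fun u _ => ?_
    rw [← card_filter]
    refine (card_le_card ?_).trans
      (card_filter_add_add_le h4 (3 * (p - 1) - (u.1 + u.2.1 + u.2.2)))
    intro t
    simp only [mem_filter, smul_eq_mul]
    exact fun h => ⟨h.1, by omega⟩
  have h : p ^ 3 * (p ^ 2 - p) = p ^ 5 - p ^ 4 := by
    rw [Nat.mul_sub]
    ring_nf
  have := Nat.pow_le_pow_right (n := p) (by omega) (show 2 ≤ 3 by omega)
  omega

theorem card_truncatedExponents_le {p : ℕ} (hp : 2 ≤ p) :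
    #(truncatedExponents (Fin 3 ⊕ Fin 3) p (3 * (p - 1))) ≤
      p ^ 5 - p ^ 4 + p ^ 3 - p ^ 2 + p := by
  refine le_trans ?_ (card_filter_sum_six_le hp)
  refine card_le_card_of_injOn (fun d => ((d (.inl 0), d (.inl 1), d (.inl 2)),
    (d (.inr 0), d (.inr 1), d (.inr 2)))) ?_ ?_
  · intro d hd
    obtain ⟨hs, hlt⟩ := mem_truncatedExponents.1 hd
    simp only [Fintype.sum_sum_type, Fin.sum_univ_three] at hs
    simp [hlt, hs]
  · intro d _ d' _ h
    simp only [Prod.mk.injEq] at h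
    ext (i | i) <;> fin_cases i <;> simp [h]

end Counting
open Matrix MvPolynomial in
/-- Let `R a` be full-rank matrices with totally isotropic row spaces. The oppositeness matrix of
these row spaces has rank at most the dimension of a graded piece of a truncated polynomial ring. -/
theorem rank_le_card_truncatedExponents {G n F : Type*} [Fintype G] [Fintype n] [DecidableEq n]
    [Field F] (p : ℕ) [Fact p.Prime] [CharP F p] (R : G → Matrix n (n ⊕ n) F)
    (hφ : ∀ x : F, frobenius F p (frobenius F p x) = x)
    (hli : ∀ a, LinearIndependent F (R a).row)
    (hR : ∀ a, R a * ((R a).map (frobenius F p))ᵀ = 0) (O : Matrix G G F)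
    (hO1 : ∀ a b, IsUnit (fromRows (R a) (R b)) → O a b = 1)
    (hO0 : ∀ a b, ¬ IsUnit (fromRows (R a) (R b)) → O a b = 0) :
    O.rank ≤ (truncatedExponents (n ⊕ n) p (Fintype.card n * (p - 1))).card := by
  set φ := frobenius F p
  choose R' hR' hne using fun a => exists_det_fromRows_ne_zero φ (hli a) (hR a)
  set δ : G → F := fun a => (fromRows (R a) (R' a)).det
  set ε : F := ((Equiv.Perm.sign (Equiv.sumComm n n) : ℤ) : F)
  have hφε : φ ε = ε := map_intCast φ _
  have hentry (a b : G) : O a b =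
      δ a * ((R a * ((R b).map φ)ᵀ).det ^ (p - 1) * (ε * (δ b)⁻¹)) := by
    have hab := det_mul_map_transpose_eq φ (R b) (hR a) (hR' a)
    have hba := det_mul_map_transpose_eq φ (R a) (hR b) (hR' b)
    have hconj : φ (R a * ((R b).map φ)ᵀ).det = (R b * ((R a).map φ)ᵀ).det := by
      rw [RingHom.map_det, RingHom.mapMatrix_apply, ← det_transpose]
      congr 1
      ext i j
      simp [mul_apply, hφ, mul_comm]
    rw [det_fromRows_swap (R b), map_mul, hφε] at hab
    by_cases hu : IsUnit (fromRows (R a) (R b))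
    · rw [hO1 a b hu]
      have hD : φ (fromRows (R a) (R b)).det ≠ 0 :=
        (map_ne_zero φ).2 ((isUnit_iff_isUnit_det _).1 hu).ne_zero
      have hpow : (R a * ((R b).map φ)ᵀ).det ^ (p - 1) * (R a * ((R b).map φ)ᵀ).det =
          δ b * φ (fromRows (R a) (R b)).det := by
        rw [← pow_succ, Nat.sub_add_cancel (Fact.out : p.Prime).one_le, ← hba, ← hconj]
        rfl
      have hcancel : (R a * ((R b).map φ)ᵀ).det ^ (p - 1) * (δ a * ε) = δ b := by
        refine mul_right_cancel₀ hD ?_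
        rw [← hpow, mul_assoc, mul_assoc (δ a), ← hab]
      have hδ : δ b ≠ 0 := hne b
      rw [← mul_inv_cancel₀ hδ]
      nth_rewrite 1 [← hcancel]
      ring
    · rw [hO0 a b hu]
      have hD : (fromRows (R a) (R b)).det = 0 := by
        by_contra h
        exact hu ((isUnit_iff_isUnit_det _).2 (isUnit_iff_ne_zero.2 h))
      have hp := (Fact.out : p.Prime).two_le
      simp [hab, hD, show p - 1 ≠ 0 by omega]
  have hfac : O =
      (of fun a (d : truncatedExponents (n ⊕ n) p (Fintype.card n * (p - 1))) =>
        δ a * coeff d.1 (rowProd p (R a))) *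
      (of fun (d : truncatedExponents (n ⊕ n) p (Fintype.card n * (p - 1))) b =>
        coeff (topExponent n p) (∏ k, (∑ j, C (((R b).map φ)ᵀ k j) * X j) ^ d.1 k) *
          (ε * (δ b)⁻¹)) := by
    ext a b
    rw [hentry, ← coeff_rowProd_eq_det_pow, coeff_rowProd_mul, Finset.sum_mul, Finset.mul_sum,
      mul_apply, ← Finset.sum_coe_sort]
    refine Finset.sum_congr rfl fun d _ => ?_
    simp only [of_apply]
    ring
  rw [hfac]
  refine (rank_mul_le_left _ _).trans ((rank_le_card_width _).trans ?_)
  rw [Fintype.card_coe]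

/-- The coordinates of a basis of a `3`-dimensional subspace, as a matrix whose columns are split
into two halves. -/
noncomputable def generatorMatrix {F : Type*} [Field F] {W : Submodule F (Fin 6 → F)}
    (b : Module.Basis (Fin 3) F W) : Matrix (Fin 3) (Fin 3 ⊕ Fin 3) F :=
  Matrix.of fun i k => (b i : Fin 6 → F) (finSumFinEquiv k)

theorem linearIndependent_row_generatorMatrix {F : Type*} [Field F]
    {W : Submodule F (Fin 6 → F)} (b : Module.Basis (Fin 3) F W) :
    LinearIndependent F (generatorMatrix b).row := by
  have hrow : (generatorMatrix b).row =
      LinearMap.funLeft F F finSumFinEquiv ∘ fun i => (b i : Fin 6 → F) := rfl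
  rw [hrow, LinearMap.linearIndependent_iff _
    (LinearMap.ker_eq_bot.2 (LinearMap.funLeft_injective_of_surjective F F _
      finSumFinEquiv.surjective))]
  exact b.linearIndependent.map' W.subtype W.ker_subtype

theorem isUnit_fromRows_iff_disjoint {F : Type*} [Field F] {U W : Submodule F (Fin 6 → F)}
    (b : Module.Basis (Fin 3) F U) (c : Module.Basis (Fin 3) F W) :
    IsUnit (Matrix.fromRows (generatorMatrix b) (generatorMatrix c)) ↔ U ⊓ W = ⊥ := by
  have hrow : (Matrix.fromRows (generatorMatrix b) (generatorMatrix c)).row =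
      LinearMap.funLeft F F finSumFinEquiv ∘
        Sum.elim (fun i => (b i : Fin 6 → F)) fun i => (c i : Fin 6 → F) := by
    ext (i | i) k <;> rfl
  have hspan {V : Submodule F (Fin 6 → F)} (d : Module.Basis (Fin 3) F V) :
      Submodule.span F (Set.range fun i => (d i : Fin 6 → F)) = V := by
    have h := congrArg (Submodule.map V.subtype) d.span_eq
    rwa [Submodule.map_span, ← Set.range_comp, Submodule.map_top, Submodule.range_subtype] at h
  rw [← Matrix.linearIndependent_rows_iff_isUnit, hrow, LinearMap.linearIndependent_iff _
    (LinearMap.ker_eq_bot.2 (LinearMap.funLeft_injective_of_surjective F F _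
      finSumFinEquiv.surjective)), linearIndependent_sum]
  have hli {V : Submodule F (Fin 6 → F)} (d : Module.Basis (Fin 3) F V) :
      LinearIndependent F fun i => (d i : Fin 6 → F) :=
    d.linearIndependent.map' V.subtype V.ker_subtype
  simp only [Sum.elim_comp_inl, Sum.elim_comp_inr, hspan, hli, true_and, disjoint_iff]

/-- The `p`-rank of the oppositeness matrix of generators of `H(5, p²)` is at most
`p⁵ - p⁴ + p³ - p² + p`. -/
theorem prank_oppositeness_H5_le (p : ℕ) (hp : p.Prime)
    (F : Type) [Field F] [Fintype F] (hF : Fintype.card F = p ^ 2)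
    (G : Type) [Fintype G]
    (e : G ≃ {W : Submodule F (Fin 6 → F) // Module.finrank F W = 3 ∧
      ∀ x ∈ W, ∀ y ∈ W, ∑ i, x i * y i ^ p = 0})
    (A : Matrix G G (ZMod p))
    (hA1 : ∀ a b : G, (e a).1 ⊓ (e b).1 = ⊥ → A a b = 1)
    (hA0 : ∀ a b : G, (e a).1 ⊓ (e b).1 ≠ ⊥ → A a b = 0) :
    A.rank ≤ p ^ 5 - p ^ 4 + p ^ 3 - p ^ 2 + p := by
  have : Fact p.Prime := ⟨hp⟩
  have : CharP F p := charP_of_card_eq_prime_pow hF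
  let B (a : G) : Module.Basis (Fin 3) F (e a).1 := Module.finBasisOfFinrankEq F _ (e a).2.1
  let R (a : G) : Matrix (Fin 3) (Fin 3 ⊕ Fin 3) F := generatorMatrix (B a)
  refine (Matrix.rank_le_rank_map (ZMod.castHom dvd_rfl F) A).trans ?_
  have hcard : (truncatedExponents (Fin 3 ⊕ Fin 3) p (Fintype.card (Fin 3) * (p - 1))).card ≤
      p ^ 5 - p ^ 4 + p ^ 3 - p ^ 2 + p := by
    rw [Fintype.card_fin]
    exact card_truncatedExponents_le hp.two_le
  refine (rank_le_card_truncatedExponents p R (fun x => ?_)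
    (fun a => linearIndependent_row_generatorMatrix (B a)) (fun a => ?_) _
    (fun a b h => ?_) (fun a b h => ?_)).trans hcard
  · rw [frobenius_def, frobenius_def, ← pow_mul, ← sq, ← hF, FiniteField.pow_card]
  · ext i j
    rw [Matrix.mul_apply, Matrix.zero_apply, ← (e a).2.2 _ (B a i).2 _ (B a j).2]
    exact (finSumFinEquiv (m := 3) (n := 3)).sum_comp fun k : Fin 6 =>
      (B a i : Fin 6 → F) k * (B a j : Fin 6 → F) k ^ p
  · rw [Matrix.map_apply, hA1 a b ((isUnit_fromRows_iff_disjoint _ _).1 h), map_one]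
  · rw [Matrix.map_apply, hA0 a b (mt (isUnit_fromRows_iff_disjoint _ _).2 h), map_zero]
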